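/- arXiv:2309.07435 — 4 statements merged into one kernel-verified Lean document; each statement's English description precedes it below -/
import Mathlib

section
/- (Adaptive conformal inference with delayed feedback, Δ = 1.) Fix α ∈ (0,1), γ > 0, a positive integer n_te, and real numbers m ≤ 0 ≤ M. Let {Err^t}_{t≥1} be an arbitrary real sequence, and for each t let PI^t : ℝ → (subsets of ℝ) be a family of sets such that PI^t(θ) = ℝ whenever θ > M and PI^t(θ) = ∅ whenever θ < m. Define recursively θ_1 = 0, c_s = 1{ Err^s ∈ PI^s(θ_s) }, and θ_{t+1} = θ_t + γ·(1 − α − c_{t − n_te + 1}) for t ≥ n_te, with θ_{t+1} = θ_t for t < n_te. Then the time-average coverage converges to the nominal level: lim_{T→∞} T^{−1} Σ_{s=1}^T c_s = 1 − α. -/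
open Filter

noncomputable section

/-- Theorem on ACI with delayed feedback, Δ = 1: the time-average
coverage of the delayed-feedback adaptive conformal inference recursion converges to
the nominal level `1 - α`.  Sequences are indexed by `ℕ` with meaningful indices
`t ≥ 1`; `c s = 1{Err^s ∈ PI^s(θ_s)}`. -/
theorem aci_delayed_feedback_coverage
    (α γ : ℝ) (hα : α ∈ Set.Ioo (0 : ℝ) 1) (hγ : 0 < γ)
    (nte : ℕ) (hnte : 0 < nte)
    (m M : ℝ) (hm : m ≤ 0) (hM : 0 ≤ M)
    (Err : ℕ → ℝ) (PI : ℕ → ℝ → Set ℝ)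
    (hPIfull : ∀ t θ', M < θ' → PI t θ' = Set.univ)
    (hPIempty : ∀ t θ', θ' < m → PI t θ' = ∅)
    (θ : ℕ → ℝ) (c : ℕ → ℝ)
    (hθ1 : θ 1 = 0)
    (hc : ∀ s, (Err s ∈ PI s (θ s) → c s = 1) ∧ (Err s ∉ PI s (θ s) → c s = 0))
    (hrec : ∀ t, nte ≤ t → θ (t + 1) = θ t + γ * (1 - α - c (t - nte + 1)))
    (hrec' : ∀ t, 1 ≤ t → t < nte → θ (t + 1) = θ t) :
    Tendsto (fun T : ℕ => (T : ℝ)⁻¹ * ∑ s ∈ Finset.Icc 1 T, c s)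
      atTop (nhds (1 - α)) := by
  obtain ⟨hα0, hα1⟩ := hα
  have hc01 : ∀ s, c s = 0 ∨ c s = 1 := by
    intro s
    by_cases h : Err s ∈ PI s (θ s)
    · exact Or.inr ((hc s).1 h)
    · exact Or.inl ((hc s).2 h)
  have hstep : ∀ j, θ (nte + j + 1) = θ (nte + j) + γ * (1 - α - c (j + 1)) := by
    intro j
    have h := hrec (nte + j) (by omega)
    rwa [show nte + j - nte + 1 = j + 1 by omega] at h
  have hinit : ∀ k, k + 1 ≤ nte → θ (k + 1) = 0 := by
    intro k
    induction k with
    | zero => intro _; exact hθ1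
    | succ k ih =>
      intro h
      rw [hrec' (k + 1) (by omega) (by omega)]
      exact ih (by omega)
  have hlip1 : ∀ t, 1 ≤ t → θ (t + 1) ≤ θ t + γ ∧ θ t - γ ≤ θ (t + 1) := by
    intro t ht
    by_cases h : t < nte
    · rw [hrec' t ht h]; constructor <;> linarith
    · rw [hrec t (by omega)]
      rcases hc01 (t - nte + 1) with h0 | h0 <;> rw [h0] <;> constructor <;> nlinarith
  have hlip : ∀ t, 1 ≤ t → ∀ k : ℕ, θ (t + k) ≤ θ t + k * γ ∧ θ t - k * γ ≤ θ (t + k) := by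
    intro t ht k
    induction k with
    | zero => simp
    | succ k ih =>
      have h := hlip1 (t + k) (by omega)
      rw [← add_assoc]
      push_cast
      constructor <;> linarith [ih.1, ih.2, h.1, h.2]
  have hn0 : (0 : ℝ) ≤ nte * γ := by positivity
  have hθn : θ nte = 0 := by
    have h := hinit (nte - 1) (by omega)
    rwa [show nte - 1 + 1 = nte by omega] at h
  have hbd : ∀ j, θ (nte + j) ≤ M + nte * γ ∧ m - nte * γ ≤ θ (nte + j) := by
    intro j
    induction j with
    | zero => rw [add_zero, hθn]; constructor <;> linarith
    | succ j ih =>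
      have hs := hstep j
      have hl := hlip (j + 1) (by omega) nte
      rw [show j + 1 + nte = nte + j + 1 by omega] at hl
      rw [← add_assoc]
      by_cases h : Err (j + 1) ∈ PI (j + 1) (θ (j + 1))
      · have hcv := (hc _).1 h
        have hmθ : m ≤ θ (j + 1) := by
          by_contra hlt
          rw [hPIempty _ _ (not_le.mp hlt)] at h
          exact h
        rw [hcv] at hs
        refine ⟨?_, by linarith [hl.2]⟩
        nlinarith [ih.1]
      · have hcv := (hc _).2 h
        have hmθ : θ (j + 1) ≤ M := by
          by_contra hlt
          rw [hPIfull _ _ (not_le.mp hlt)] at h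
          exact h (Set.mem_univ _)
        rw [hcv] at hs
        refine ⟨by linarith [hl.1], ?_⟩
        nlinarith [ih.2]
  have hsum : ∀ T : ℕ, θ (nte + T) = γ * (T * (1 - α) - ∑ s ∈ Finset.Icc 1 T, c s) := by
    intro T
    induction T with
    | zero => simp [hθn]
    | succ T ih =>
      rw [Finset.sum_Icc_succ_top (by omega), ← add_assoc, hstep, ih]
      push_cast
      ring
  have hlim : Tendsto (fun T : ℕ => (T : ℝ)⁻¹ * (θ (nte + T) / γ)) atTop (nhds 0) := by
    have h0 : Tendsto (fun T : ℕ => (T : ℝ)⁻¹) atTop (nhds 0) :=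
      tendsto_inv_atTop_nhds_zero_nat
    have hlo := h0.mul_const ((m - nte * γ) / γ)
    have hhi := h0.mul_const ((M + nte * γ) / γ)
    rw [zero_mul] at hlo hhi
    refine tendsto_of_tendsto_of_tendsto_of_le_of_le hlo hhi ?_ ?_
    · intro T
      have := (hbd T).2
      dsimp only
      gcongr
    · intro T
      have := (hbd T).1
      dsimp only
      gcongr
  have hfin := hlim.const_sub (1 - α)
  rw [sub_zero] at hfin
  refine hfin.congr' ?_
  filter_upwards [eventually_gt_atTop 0] with T hT
  have hT' : (T : ℝ) ≠ 0 := by positivity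
  rw [hsum T]
  field_simp
  ring
end
end

section
/- Fix α ∈ (0,1), γ > 0, a positive integer n_te, and real numbers m ≤ 0 ≤ M. Let {Err^t}_{t≥1} be an arbitrary real sequence and for each t let PI^t : ℝ → (subsets of ℝ) satisfy PI^t(θ) = ℝ for θ > M and PI^t(θ) = ∅ for θ < m. Define θ_1 = 0, c_s = 1{ Err^s ∈ PI^s(θ_s) }, θ_{t+1} = θ_t + γ·(1 − α − c_{t − n_te + 1}) for t ≥ n_te, and θ_{t+1} = θ_t for t < n_te. Then for every t ≥ 1, θ_t ∈ [ m − n_te·γ, M + n_te·γ ]. -/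
open Filter

noncomputable section

/-- Lemma C.1 of the paper: the parameter sequence of the
delayed-feedback adaptive conformal inference recursion stays in the interval
`[m - n_te·γ, M + n_te·γ]`.  Sequences are indexed by `ℕ` with meaningful indices
`t ≥ 1`; `c s = 1{Err^s ∈ PI^s(θ_s)}`. -/
theorem aci_delayed_feedback_theta_bounded
    (α γ : ℝ) (hα : α ∈ Set.Ioo (0 : ℝ) 1) (hγ : 0 < γ)
    (nte : ℕ) (hnte : 0 < nte)
    (m M : ℝ) (hm : m ≤ 0) (hM : 0 ≤ M)
    (Err : ℕ → ℝ) (PI : ℕ → ℝ → Set ℝ)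
    (hPIfull : ∀ t θ', M < θ' → PI t θ' = Set.univ)
    (hPIempty : ∀ t θ', θ' < m → PI t θ' = ∅)
    (θ : ℕ → ℝ) (c : ℕ → ℝ)
    (hθ1 : θ 1 = 0)
    (hc : ∀ s, (Err s ∈ PI s (θ s) → c s = 1) ∧ (Err s ∉ PI s (θ s) → c s = 0))
    (hrec : ∀ t, nte ≤ t → θ (t + 1) = θ t + γ * (1 - α - c (t - nte + 1)))
    (hrec' : ∀ t, 1 ≤ t → t < nte → θ (t + 1) = θ t) :
    ∀ t, 1 ≤ t → m - (nte : ℝ) * γ ≤ θ t ∧ θ t ≤ M + (nte : ℝ) * γ := by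
  obtain ⟨hα0, hα1⟩ := hα
  have hc01 : ∀ s, 0 ≤ c s ∧ c s ≤ 1 := by
    intro s
    by_cases h : Err s ∈ PI s (θ s)
    · rw [(hc s).1 h]; norm_num
    · rw [(hc s).2 h]; norm_num
  have hstep : ∀ t, 1 ≤ t → θ t - γ ≤ θ (t + 1) ∧ θ (t + 1) ≤ θ t + γ := by
    intro t ht
    rcases lt_or_ge t nte with h | h
    · rw [hrec' t ht h]; constructor <;> linarith
    · rw [hrec t h]
      obtain ⟨h0, h1⟩ := hc01 (t - nte + 1)
      constructor <;> nlinarith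
  have hk : ∀ k a : ℕ, 1 ≤ a → θ a - k * γ ≤ θ (a + k) ∧ θ (a + k) ≤ θ a + k * γ := by
    intro k a ha
    induction k with
    | zero => simp
    | succ k ih =>
      obtain ⟨h1, h2⟩ := hstep (a + k) (by omega)
      rw [← add_assoc]
      push_cast
      constructor <;> linarith [ih.1, ih.2]
  have hn : 0 ≤ (nte : ℝ) * γ := by positivity
  intro t ht
  induction t, ht using Nat.le_induction with
  | base => rw [hθ1]; constructor <;> linarith
  | succ t ht ih =>
    rcases lt_or_ge t nte with h | h
    · rw [hrec' t ht h]; exact ih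
    · have hr := hrec t h
      obtain ⟨k1, k2⟩ := hk nte (t - nte + 1) (by omega)
      have e : t - nte + 1 + nte = t + 1 := by omega
      rw [e] at k1 k2
      have hcs := hc (t - nte + 1)
      obtain ⟨h0, h1⟩ := hc01 (t - nte + 1)
      constructor
      · rcases lt_or_ge (θ (t - nte + 1)) m with hlt | hge
        · have hz := hcs.2 (by rw [hPIempty _ _ hlt]; simp)
          rw [hz] at hr
          nlinarith [ih.1]
        · linarith
      · rcases lt_or_ge M (θ (t - nte + 1)) with hlt | hge
        · have hz := hcs.1 (by rw [hPIfull _ _ hlt]; simp)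
          rw [hz] at hr
          nlinarith [ih.2]
        · linarith
end
end

section
/- Fix α ∈ (0,1), γ > 0, a positive integer n_te, and real numbers m ≤ 0 ≤ M. Let {Err^t}_{t≥1} be an arbitrary real sequence and for each t let PI^t : ℝ → (subsets of ℝ) satisfy PI^t(θ) = ℝ for θ > M and PI^t(θ) = ∅ for θ < m. Define θ_1 = 0, c_s = 1{ Err^s ∈ PI^s(θ_s) }, θ_{t+1} = θ_t + γ·(1 − α − c_{t − n_te + 1}) for t ≥ n_te, and θ_{t+1} = θ_t for t < n_te. Then for every T ≥ n_te, | T^{−1} Σ_{s=1}^T (1 − α − c_s) | ≤ ( (M − m) + 3·n_te·γ ) / (T·γ). -/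
open Filter

noncomputable section

theorem aci_upper (S : ℕ → ℝ) (γ M : ℝ) (n : ℕ) (hγ : 0 < γ) (hn : 0 < n) (hM : 0 ≤ M)
    (h0 : S 0 = 0) (h1 : ∀ k, S (k + 1) ≤ S k + 1)
    (h2 : ∀ k, M < γ * S (k + 1 - n) → S (k + 1) ≤ S k) (k : ℕ) :
    γ * S k ≤ M + n * γ := by
  have hstep : ∀ a j, S (a + j) ≤ S a + j := by
    intro a j
    induction j with
    | zero => simp
    | succ j ih =>
      have := h1 (a + j)
      rw [← add_assoc]
      push_cast
      linarith
  induction k with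
  | zero => rw [h0]; have : 0 ≤ (n : ℝ) * γ := by positivity
            linarith
  | succ k ih =>
    by_cases h : M < γ * S (k + 1 - n)
    · have := mul_le_mul_of_nonneg_left (h2 k h) hγ.le
      linarith
    · push Not at h
      obtain ⟨j, hj, hjn⟩ : ∃ j, k + 1 = (k + 1 - n) + j ∧ j ≤ n := by
        exact ⟨k + 1 - (k + 1 - n), by omega, by omega⟩
      have h3 := hstep (k + 1 - n) j
      rw [← hj] at h3
      have h4 : (j : ℝ) ≤ n := by exact_mod_cast hjn
      have h5 := mul_le_mul_of_nonneg_left (h3.trans (by linarith : _ ≤ S (k + 1 - n) + n)) hγ.le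
      linarith

/-- the quantitative time-average coverage bound for the
delayed-feedback adaptive conformal inference recursion.  Sequences are indexed by
`ℕ` with meaningful indices `t ≥ 1`; `c s = 1{Err^s ∈ PI^s(θ_s)}`. -/
theorem aci_delayed_feedback_coverage_bound
    (α γ : ℝ) (hα : α ∈ Set.Ioo (0 : ℝ) 1) (hγ : 0 < γ)
    (nte : ℕ) (hnte : 0 < nte)
    (m M : ℝ) (hm : m ≤ 0) (hM : 0 ≤ M)
    (Err : ℕ → ℝ) (PI : ℕ → ℝ → Set ℝ)
    (hPIfull : ∀ t θ', M < θ' → PI t θ' = Set.univ)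
    (hPIempty : ∀ t θ', θ' < m → PI t θ' = ∅)
    (θ : ℕ → ℝ) (c : ℕ → ℝ)
    (hθ1 : θ 1 = 0)
    (hc : ∀ s, (Err s ∈ PI s (θ s) → c s = 1) ∧ (Err s ∉ PI s (θ s) → c s = 0))
    (hrec : ∀ t, nte ≤ t → θ (t + 1) = θ t + γ * (1 - α - c (t - nte + 1)))
    (hrec' : ∀ t, 1 ≤ t → t < nte → θ (t + 1) = θ t) :
    ∀ T : ℕ, nte ≤ T →
      |(T : ℝ)⁻¹ * ∑ s ∈ Finset.Icc 1 T, (1 - α - c s)|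
        ≤ ((M - m) + 3 * (nte : ℝ) * γ) / ((T : ℝ) * γ) := by
  obtain ⟨hα0, hα1⟩ := hα
  have hc01 : ∀ s, c s = 1 ∨ c s = 0 := fun s => by
    by_cases h : Err s ∈ PI s (θ s)
    · exact Or.inl ((hc s).1 h)
    · exact Or.inr ((hc s).2 h)
  have hup : ∀ s, M < θ s → c s = 1 := fun s h => (hc s).1 (by rw [hPIfull s _ h]; trivial)
  have hlo : ∀ s, θ s < m → c s = 0 := fun s h => (hc s).2 (by rw [hPIempty s _ h]; simp)
  set S : ℕ → ℝ := fun k => ∑ s ∈ Finset.Icc 1 k, (1 - α - c s) with hS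
  have hS0 : S 0 = 0 := by simp [hS]
  have hSs : ∀ k, S (k + 1) = S k + (1 - α - c (k + 1)) := fun k => by
    simp only [hS]
    rw [Finset.sum_Icc_succ_top (by omega)]
  have hθ : ∀ k, θ (k + 1) = γ * S (k + 1 - nte) := by
    intro k
    induction k with
    | zero =>
      rw [show 0 + 1 - nte = 0 by omega, hS0]
      simpa using hθ1
    | succ k ih =>
      by_cases h : nte ≤ k + 1
      · rw [hrec _ h, ih, show k + 1 + 1 - nte = (k + 1 - nte) + 1 by omega, hSs]
        ring
      · rw [hrec' _ (by omega) (by omega), ih, show k + 1 + 1 - nte = 0 by omega,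
          show k + 1 - nte = 0 by omega]
  intro T hT
  have hA := aci_upper S γ M nte hγ hnte hM hS0
    (fun k => by rw [hSs]; rcases hc01 (k + 1) with h | h <;> rw [h] <;> linarith)
    (fun k h => by
      rw [← hθ] at h
      rw [hSs, hup _ h]; linarith) T
  have hB := aci_upper (fun k => - S k) γ (-m) nte hγ hnte (by linarith) (by simp [hS0])
    (fun k => by
      show - S (k + 1) ≤ - S k + 1
      rw [hSs]; rcases hc01 (k + 1) with h | h <;> rw [h] <;> linarith)
    (fun k h => by
      have h' : θ (k + 1) < m := by rw [hθ]; linarith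
      show - S (k + 1) ≤ - S k
      rw [hSs, hlo _ h']; linarith) T
  have hTp : (0 : ℝ) < T := by exact_mod_cast (by omega : 0 < T)
  have hn : 0 ≤ (nte : ℝ) * γ := by positivity
  change |(T : ℝ)⁻¹ * S T| ≤ _
  rw [le_div_iff₀ (by positivity), abs_mul, abs_of_pos (inv_pos.mpr hTp)]
  have : (T : ℝ)⁻¹ * |S T| * (T * γ) = |γ * S T| := by
    rw [abs_mul, abs_of_pos hγ]; field_simp
  rw [this, abs_le]
  constructor <;> linarith
end
end

section
/- Let m ≥ 1 and let (X, Y) be an (ℝ^m × ℝ)-valued random vector. Suppose there is a constant C ≥ 0 such that for almost every x with respect to the law of X, the regular conditional distribution of Y given X = x has a density with respect to Lebesgue measure bounded above by C. Then for all measurable functions f, g : ℝ^m → ℝ with E[|f(X) − g(X)|] < ∞, | P( Y ≤ f(X) ) − P( Y ≤ g(X) ) | ≤ C · E[ | f(X) − g(X) | ]. -/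
open MeasureTheory ProbabilityTheory Filter

noncomputable section

theorem threshold_aux
    {Ω : Type*} [MeasurableSpace Ω] (μ : Measure Ω) [IsProbabilityMeasure μ]
    (m : ℕ)
    (X : Ω → (Fin m → ℝ)) (Y : Ω → ℝ)
    (hX : Measurable X) (hY : Measurable Y)
    (C : ℝ) (hC : 0 ≤ C)
    (κ : Kernel (Fin m → ℝ) ℝ) [IsMarkovKernel κ]
    (hκ : μ.map (fun ω => (X ω, Y ω)) = (μ.map X) ⊗ₘ κ)
    (hcdens : ∀ᵐ x ∂(μ.map X), ∃ d : ℝ → ENNReal, (∀ y, d y ≤ ENNReal.ofReal C) ∧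
      κ x = volume.withDensity d)
    (f g : (Fin m → ℝ) → ℝ) (hf : Measurable f) (hg : Measurable g)
    (hint : Integrable (fun ω => |f (X ω) - g (X ω)|) μ) :
    (μ {ω | Y ω ≤ f (X ω)}).toReal - (μ {ω | Y ω ≤ g (X ω)}).toReal
      ≤ C * ∫ ω, |f (X ω) - g (X ω)| ∂μ := by
  haveI : IsProbabilityMeasure (μ.map X) := Measure.isProbabilityMeasure_map hX.aemeasurable
  have key : ∀ h : (Fin m → ℝ) → ℝ, Measurable h →
      μ {ω | Y ω ≤ h (X ω)} = ∫⁻ x, κ x (Set.Iic (h x)) ∂(μ.map X) := by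
    intro h hh
    have hs : MeasurableSet {p : (Fin m → ℝ) × ℝ | p.2 ≤ h p.1} :=
      measurableSet_le measurable_snd (hh.comp measurable_fst)
    have h1 := Measure.map_apply (μ := μ) (hX.prodMk hY) hs
    rw [hκ, Measure.compProd_apply hs] at h1
    exact h1.symm
  have hm1 : Measurable (fun x => ENNReal.ofReal C * ENNReal.ofReal |f x - g x|) := by
    fun_prop
  have hle : μ {ω | Y ω ≤ f (X ω)} ≤ μ {ω | Y ω ≤ g (X ω)} +
      ENNReal.ofReal (C * ∫ ω, |f (X ω) - g (X ω)| ∂μ) := by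
    have e : ENNReal.ofReal (C * ∫ ω, |f (X ω) - g (X ω)| ∂μ)
        = ∫⁻ x, ENNReal.ofReal C * ENNReal.ofReal |f x - g x| ∂(μ.map X) := by
      rw [lintegral_map hm1 hX, lintegral_const_mul _ (by fun_prop), ENNReal.ofReal_mul hC,
        ofReal_integral_eq_lintegral_ofReal hint (ae_of_all _ fun _ => abs_nonneg _)]
    rw [e, key f hf, key g hg, ← lintegral_add_right _ hm1]
    refine lintegral_mono_ae ?_
    filter_upwards [hcdens] with x hx
    obtain ⟨d, hd, hk⟩ := hx
    have hsub : Set.Iic (f x) ⊆ Set.Iic (g x) ∪ Set.Ioc (g x) (f x) := by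
      intro y hy
      rcases le_or_gt y (g x) with h | h
      · exact Or.inl h
      · exact Or.inr ⟨h, hy⟩
    refine (measure_mono hsub).trans ((measure_union_le _ _).trans ?_)
    gcongr
    rw [hk, withDensity_apply _ measurableSet_Ioc]
    calc ∫⁻ y in Set.Ioc (g x) (f x), d y
        ≤ ∫⁻ y in Set.Ioc (g x) (f x), ENNReal.ofReal C := lintegral_mono hd
      _ = ENNReal.ofReal C * ENNReal.ofReal (f x - g x) := by
        rw [setLIntegral_const, Real.volume_Ioc]
      _ ≤ _ := by gcongr; exact le_abs_self _
  have hnn : 0 ≤ C * ∫ ω, |f (X ω) - g (X ω)| ∂μ :=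
    mul_nonneg hC (integral_nonneg fun _ => abs_nonneg _)
  have h2 := ENNReal.toReal_mono (by finiteness) hle
  rw [ENNReal.toReal_add (by finiteness) (by finiteness), ENNReal.toReal_ofReal hnn] at h2
  linarith

/-- if the regular conditional distribution of `Y` given `X = x` has a
Lebesgue density bounded by `C` (for almost every `x`), then threshold-crossing
probabilities change by at most `C` times the `L¹` distance of the thresholds. -/
theorem threshold_probability_comparison
    {Ω : Type*} [MeasurableSpace Ω] (μ : Measure Ω) [IsProbabilityMeasure μ]
    (m : ℕ) (hm : 1 ≤ m)
    (X : Ω → (Fin m → ℝ)) (Y : Ω → ℝ)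
    (hX : Measurable X) (hY : Measurable Y)
    (C : ℝ) (hC : 0 ≤ C)
    (κ : Kernel (Fin m → ℝ) ℝ) [IsMarkovKernel κ]
    (hκ : μ.map (fun ω => (X ω, Y ω)) = (μ.map X) ⊗ₘ κ)
    (hcdens : ∀ᵐ x ∂(μ.map X), ∃ d : ℝ → ENNReal, (∀ y, d y ≤ ENNReal.ofReal C) ∧
      κ x = volume.withDensity d)
    (f g : (Fin m → ℝ) → ℝ) (hf : Measurable f) (hg : Measurable g)
    (hint : Integrable (fun ω => |f (X ω) - g (X ω)|) μ) :
    |(μ {ω | Y ω ≤ f (X ω)}).toReal - (μ {ω | Y ω ≤ g (X ω)}).toReal|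
      ≤ C * ∫ ω, |f (X ω) - g (X ω)| ∂μ := by
  rw [abs_le]
  have h1 := threshold_aux μ m X Y hX hY C hC κ hκ hcdens f g hf hg hint
  have h2 := threshold_aux μ m X Y hX hY C hC κ hκ hcdens g f hg hf
    (by simpa only [abs_sub_comm] using hint)
  have e : ∫ ω, |g (X ω) - f (X ω)| ∂μ = ∫ ω, |f (X ω) - g (X ω)| ∂μ := by
    congr 1; ext ω; exact abs_sub_comm _ _
  rw [e] at h2
  constructor <;> linarith
end
end
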